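/- arXiv:0901.2838 — 2 statements merged into one kernel-verified Lean document; each statement's English description precedes it below -/
import Mathlib

section
/- (Verification of Theorem 1, check–check part.) For all k, j ∈ {1,…,d−1}, the function δ_{r_k,r_j} is differentiable on (0, ∞) and satisfies, for all y > 0, d/dy δ_{r_k,r_j}(y) = ((b−1)/y)·( (k+j)·δ_{r_k,r_j}(y) + H_{k,j}(y) + H_{j,k}(y) − ( ē_l(y)/(b−1) )·f̂_{k,j}(y) ), where H_{k,j}(y) = k·( ( ē_{r_{k+1}}(y) − ē_{r_k}(y) )/ē_l(y) )·δ_{l,r_j}(y) − 1_{k≠d−1}·k·δ_{r_{k+1},r_j}(y) − 1_{k=d−1}·(d−1)·( δ_{l,r_j}(y) − Σ_{m=1}^{d−1} δ_{r_j,r_m}(y) ), and f̂_{k,j}(y) = k·j·((b−1)/ē_l(y))·( −( ē_{r_{k+1}}(y) − ē_{r_k}(y) )·( ē_{r_{j+1}}(y) − ē_{r_j}(y) )/ē_l(y) + 1_{k=j}·( ē_{r_{j+1}}(y) + ē_{r_j}(y) ) − 1_{k=j+1}·ē_{r_k}(y) − 1_{j=k+1}·ē_{r_j}(y) ). -/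
open Finset Filter

/-- `x(y) = ε·y^(b−1)`. -/
noncomputable def xx (b : ℕ) (ε y : ℝ) : ℝ := ε * y ^ (b - 1)

/-- `G_j(y) = C(d−1,j−1)·x^(j−1)·x̃^(d−j−1)·(d·x − j) + 1_{j=1}` for `j ∈ {1,…,d−1}`. -/
noncomputable def G (b d : ℕ) (ε : ℝ) (j : ℕ) (y : ℝ) : ℝ :=
  (Nat.choose (d - 1) (j - 1) : ℝ) * xx b ε y ^ (j - 1) *
      (1 - xx b ε y) ^ (d - j - 1) * ((d : ℝ) * xx b ε y - (j : ℝ)) +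
    (if j = 1 then (1 : ℝ) else 0)

/-- `G_d(y) = −d·x^(d−1)`. -/
noncomputable def Gd (b d : ℕ) (ε y : ℝ) : ℝ := -(d : ℝ) * xx b ε y ^ (d - 1)

/-- `ē_l(y) = x·y`. -/
noncomputable def el (b : ℕ) (ε y : ℝ) : ℝ := xx b ε y * y

/-- `ē_{r_1}(y) = x·(y − 1 + x̃^(d−1))` and `ē_{r_j}(y) = C(d−1,j−1)·x^j·x̃^(d−j)` for `j ≥ 2`. -/
noncomputable def er (b d : ℕ) (ε : ℝ) (j : ℕ) (y : ℝ) : ℝ :=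
  if j = 1 then xx b ε y * (y - 1 + (1 - xx b ε y) ^ (d - 1))
  else (Nat.choose (d - 1) (j - 1) : ℝ) * xx b ε y ^ j * (1 - xx b ε y) ^ (d - j)

/-- `δ_{l,r_j}(y) = −G_j(y)·(ε·ε̃·(b−1)/y + ε̃·x) + 1_{j=1}·b·ε·ε̃`. -/
noncomputable def dlr (b d : ℕ) (ε : ℝ) (j : ℕ) (y : ℝ) : ℝ :=
  -(G b d ε j y) * (ε * (1 - ε) * ((b : ℝ) - 1) / y + (1 - ε) * xx b ε y) +
    (if j = 1 then (1 : ℝ) else 0) * ((b : ℝ) * ε * (1 - ε))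

/-- `δ_{r_k,r_j}(y)` as in Theorem 1. -/
noncomputable def drr (b d : ℕ) (ε : ℝ) (k j : ℕ) (y : ℝ) : ℝ :=
  (((b : ℝ) - 1) / (b : ℝ)) * G b d ε k y * G b d ε j y *
      (ε * (1 - ε) * ((b : ℝ) - 1) / y ^ 2 - (ε - (1 - ε)) * xx b ε y / y + xx b ε y ^ 2)
    - (d : ℝ) * (Nat.choose (d - 1) (k - 1) : ℝ) * (Nat.choose (d - 1) (j - 1) : ℝ) *
        xx b ε y ^ (k + j) * (1 - xx b ε y) ^ (2 * d - k - j)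
    + (if k = j then (1 : ℝ) else 0) * (k : ℝ) * (Nat.choose (d - 1) (k - 1) : ℝ) *
        xx b ε y ^ k * (1 - xx b ε y) ^ (d - k)
    + (if k = 1 ∧ j = 1 then (1 : ℝ) else 0) *
        ((b : ℝ) * ε * (1 - ε) - xx b ε y * (1 - xx b ε y))
    - ((if k = 1 then (1 : ℝ) else 0) * G b d ε j y +
        (if j = 1 then (1 : ℝ) else 0) * G b d ε k y) *
        (ε * (1 - ε) * ((b : ℝ) - 1) / y - ε * xx b ε y + xx b ε y ^ 2)

/-- `H_{k,j}(y) = k·((ē_{r_{k+1}} − ē_{r_k})/ē_l)·δ_{l,r_j} − 1_{k≠d−1}·k·δ_{r_{k+1},r_j}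
  − 1_{k=d−1}·(d−1)·(δ_{l,r_j} − Σ_{m=1}^{d−1} δ_{r_j,r_m})`. -/
noncomputable def Hfun (b d : ℕ) (ε : ℝ) (k j : ℕ) (y : ℝ) : ℝ :=
  (k : ℝ) * ((er b d ε (k + 1) y - er b d ε k y) / el b ε y) * dlr b d ε j y -
    (if k ≠ d - 1 then (1 : ℝ) else 0) * (k : ℝ) * drr b d ε (k + 1) j y -
    (if k = d - 1 then (1 : ℝ) else 0) * ((d : ℝ) - 1) *
      (dlr b d ε j y - ∑ m ∈ Finset.Icc 1 (d - 1), drr b d ε j m y)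

/-- `f̂_{k,j}(y) = k·j·((b−1)/ē_l)·( −(ē_{r_{k+1}} − ē_{r_k})·(ē_{r_{j+1}} − ē_{r_j})/ē_l
  + 1_{k=j}·(ē_{r_{j+1}} + ē_{r_j}) − 1_{k=j+1}·ē_{r_k} − 1_{j=k+1}·ē_{r_j} )`. -/
noncomputable def fhat (b d : ℕ) (ε : ℝ) (k j : ℕ) (y : ℝ) : ℝ :=
  (k : ℝ) * (j : ℝ) * (((b : ℝ) - 1) / el b ε y) *
    (-((er b d ε (k + 1) y - er b d ε k y) * (er b d ε (j + 1) y - er b d ε j y)) / el b ε y +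
      (if k = j then (1 : ℝ) else 0) * (er b d ε (j + 1) y + er b d ε j y) -
      (if k = j + 1 then (1 : ℝ) else 0) * er b d ε k y -
      (if j = k + 1 then (1 : ℝ) else 0) * er b d ε j y)

/-- `C(d−1,j−1)·x^j·(1−x)^(d−j)`, which vanishes at `j = d + 1`. -/
noncomputable def binomTerm (d j : ℕ) (x : ℝ) : ℝ :=
  (Nat.choose (d - 1) (j - 1) : ℝ) * x ^ j * (1 - x) ^ (d - j)

/-- The form of `G_j` in terms of `binomTerm`, which also covers `j = d`. -/
noncomputable def slopeTerm (d j : ℕ) (x : ℝ) : ℝ :=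
  (j : ℝ) * (binomTerm d (j + 1) x - binomTerm d j x) / x + (if j = 1 then (1 : ℝ) else 0)

/-- The form of `δ_{r_k,r_j}` in terms of `slopeTerm` and `binomTerm`, which also covers the
index `d`. -/
noncomputable def covExt (b d : ℕ) (ε : ℝ) (k j : ℕ) (y : ℝ) : ℝ :=
  (((b : ℝ) - 1) / (b : ℝ)) * slopeTerm d k (xx b ε y) * slopeTerm d j (xx b ε y) *
      (ε * (1 - ε) * ((b : ℝ) - 1) / y ^ 2 - (ε - (1 - ε)) * xx b ε y / y + xx b ε y ^ 2)
    - (d : ℝ) * binomTerm d k (xx b ε y) * binomTerm d j (xx b ε y)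
    + (if k = j then (1 : ℝ) else 0) * (k : ℝ) * binomTerm d k (xx b ε y)
    + (if k = 1 ∧ j = 1 then (1 : ℝ) else 0) *
        ((b : ℝ) * ε * (1 - ε) - xx b ε y * (1 - xx b ε y))
    - ((if k = 1 then (1 : ℝ) else 0) * slopeTerm d j (xx b ε y) +
        (if j = 1 then (1 : ℝ) else 0) * slopeTerm d k (xx b ε y)) *
        (ε * (1 - ε) * ((b : ℝ) - 1) / y - ε * xx b ε y + xx b ε y ^ 2)

lemma xx_pos {b : ℕ} {ε y : ℝ} (hε : 0 < ε) (hy : 0 < y) : 0 < xx b ε y := by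
  unfold xx; positivity

lemma hasDerivAt_xx {b : ℕ} (hb : 2 ≤ b) (ε : ℝ) {y : ℝ} (hy : y ≠ 0) :
    HasDerivAt (xx b ε) (((b : ℝ) - 1) / y * xx b ε y) y := by
  obtain ⟨n, rfl⟩ := Nat.exists_eq_add_of_le' hb
  have h := (hasDerivAt_pow (n + 1) y).const_mul ε
  refine h.congr_deriv ?_
  simp only [xx, show n + 2 - 1 = n + 1 by lia]
  push_cast
  field_simp
  ring

lemma binomTerm_succ_self {d : ℕ} (hd : 1 ≤ d) (x : ℝ) : binomTerm d (d + 1) x = 0 := by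
  simp [binomTerm, Nat.choose_eq_zero_of_lt (show d - 1 < d by lia)]

lemma mul_choose_succ_right {d j : ℕ} (hj : 1 ≤ j) (hjd : j ≤ d) :
    (j : ℝ) * (Nat.choose (d - 1) j : ℝ) = ((d : ℝ) - j) * (Nat.choose (d - 1) (j - 1) : ℝ) := by
  have h := Nat.choose_succ_right_eq (d - 1) (j - 1)
  rw [show j - 1 + 1 = j by lia, show d - 1 - (j - 1) = d - j by lia] at h
  have h' : ((Nat.choose (d - 1) j * j : ℕ) : ℝ) =
      ((Nat.choose (d - 1) (j - 1) * (d - j) : ℕ) : ℝ) := congrArg _ h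
  rw [Nat.cast_mul, Nat.cast_mul, Nat.cast_sub hjd] at h'
  linarith

/-- Consecutive binomial terms differ by the `G`-type expression. -/
lemma mul_binomTerm_succ_sub {d j : ℕ} (hj : 1 ≤ j) (hjd : j < d) (x : ℝ) :
    (j : ℝ) * (binomTerm d (j + 1) x - binomTerm d j x) =
      (Nat.choose (d - 1) (j - 1) : ℝ) * x ^ j * (1 - x) ^ (d - j - 1) * ((d : ℝ) * x - j) := by
  have h := mul_choose_succ_right hj hjd.le
  simp only [binomTerm, Nat.add_sub_cancel]
  obtain ⟨m, rfl⟩ := Nat.exists_eq_add_of_lt hjd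
  rw [show j + m + 1 - (j + 1) = m by lia, show j + m + 1 - j = m + 1 by lia,
    Nat.add_sub_cancel m 1]
  linear_combination x ^ (j + 1) * (1 - x) ^ m * h

lemma hasDerivAt_binomTerm {d j : ℕ} (hj : 1 ≤ j) (hjd : j ≤ d) {x : ℝ} (hx : x ≠ 0) :
    HasDerivAt (binomTerm d j) ((j : ℝ) * (binomTerm d j x - binomTerm d (j + 1) x) / x) x := by
  have h := ((hasDerivAt_pow j x).const_mul (Nat.choose (d - 1) (j - 1) : ℝ)).mul
    (((hasDerivAt_id x).const_sub 1).pow (d - j))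
  refine h.congr_deriv ?_
  rcases hjd.lt_or_eq with hlt | rfl
  · rw [show (j : ℝ) * (binomTerm d j x - binomTerm d (j + 1) x) =
      -(j * (binomTerm d (j + 1) x - binomTerm d j x)) by ring, mul_binomTerm_succ_sub hj hlt]
    obtain ⟨m, rfl⟩ := Nat.exists_eq_add_of_lt hlt
    obtain ⟨i, rfl⟩ := Nat.exists_eq_add_of_le' hj
    rw [show i + 1 + m + 1 - (i + 1) = m + 1 by lia]
    simp only [Nat.add_sub_cancel, id, Pi.pow_apply]
    push_cast
    field_simp
    ring
  · rw [binomTerm_succ_self hj]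
    obtain ⟨i, rfl⟩ := Nat.exists_eq_add_of_le' hj
    simp [binomTerm]
    field_simp
    ring

lemma hasDerivAt_slopeTerm {d j : ℕ} (hj : 1 ≤ j) (hjd : j < d) {x : ℝ} (hx : x ≠ 0) :
    HasDerivAt (slopeTerm d j) ((((j : ℝ) - 1) * slopeTerm d j x - j * slopeTerm d (j + 1) x) / x) x := by
  have h := (((((hasDerivAt_binomTerm (show 1 ≤ j + 1 by lia) hjd hx).sub
    (hasDerivAt_binomTerm hj hjd.le hx)).const_mul (j : ℝ)).div (hasDerivAt_id x) hx).add_const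
      (if j = 1 then (1 : ℝ) else 0))
  refine h.congr_deriv ?_
  have hne : j + 1 ≠ 1 := by lia
  have h1 : ((j : ℝ) - 1) * (if j = 1 then (1 : ℝ) else 0) = 0 := by
    split_ifs with hj1 <;> simp [hj1]
  simp only [slopeTerm, if_neg hne, id, mul_add, h1, Pi.sub_apply]
  push_cast
  field_simp
  ring

lemma G_eq_slopeTerm {b d j : ℕ} {ε y : ℝ} (hj : 1 ≤ j) (hjd : j < d) (hx : xx b ε y ≠ 0) :
    G b d ε j y = slopeTerm d j (xx b ε y) := by
  rw [G, slopeTerm, mul_binomTerm_succ_sub hj hjd]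
  obtain ⟨i, rfl⟩ := Nat.exists_eq_add_of_le' hj
  simp only [Nat.add_sub_cancel]
  field_simp
  ring

lemma er_eq {b d j : ℕ} {ε y : ℝ} :
    er b d ε j y = binomTerm d j (xx b ε y) +
      (if j = 1 then (1 : ℝ) else 0) * (xx b ε y * (y - 1)) := by
  unfold er binomTerm
  split_ifs with h
  · subst h; simp; ring
  · ring

lemma drr_eq_covExt {b d k j : ℕ} {ε y : ℝ} (hk : 1 ≤ k) (hkd : k < d) (hj : 1 ≤ j) (hjd : j < d)
    (hx : xx b ε y ≠ 0) : drr b d ε k j y = covExt b d ε k j y := by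
  rw [drr, covExt, G_eq_slopeTerm hk hkd hx, G_eq_slopeTerm hj hjd hx]
  simp only [binomTerm]
  rw [show 2 * d - k - j = (d - k) + (d - j) by lia, pow_add, pow_add]
  ring

lemma sum_binomTerm {d : ℕ} (hd : 1 ≤ d) (x : ℝ) : ∑ m ∈ Icc 1 d, binomTerm d m x = x := by
  obtain ⟨n, rfl⟩ := Nat.exists_eq_add_of_le' hd
  have h := add_pow x (1 - x) n
  rw [add_sub_cancel, one_pow] at h
  rw [← Finset.Ico_add_one_right_eq_Icc, Finset.sum_Ico_eq_sum_range]
  calc _ = ∑ m ∈ range (n + 1), x * (x ^ m * (1 - x) ^ (n - m) * (n.choose m : ℝ)) := by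
        refine sum_congr (by simp) fun m hm => ?_
        simp only [binomTerm, Nat.add_sub_cancel, Nat.add_sub_cancel_left]
        rw [show n + 1 - (1 + m) = n - m by lia]
        ring
    _ = x := by rw [← mul_sum, ← h, mul_one]

lemma sum_mul_sub (f : ℕ → ℝ) (n : ℕ) :
    ∑ m ∈ Icc 1 n, (m : ℝ) * (f (m + 1) - f m) = n * f (n + 1) - ∑ m ∈ Icc 1 n, f m := by
  induction n with
  | zero => simp
  | succ n ih =>
    rw [sum_Icc_succ_top (by lia), sum_Icc_succ_top (by lia), ih]
    push_cast
    ring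

lemma sum_slopeTerm {d : ℕ} (hd : 1 ≤ d) {x : ℝ} (hx : x ≠ 0) : ∑ m ∈ Icc 1 d, slopeTerm d m x = 0 := by
  simp only [slopeTerm]
  rw [sum_add_distrib, ← sum_div, sum_mul_sub (fun m => binomTerm d m x), sum_binomTerm hd,
    binomTerm_succ_self hd, sum_ite_eq' (Icc 1 d) 1, if_pos (by simp [hd])]
  field_simp
  ring

lemma sum_covExt {b d j : ℕ} {ε y : ℝ} (hj : 1 ≤ j) (hjd : j < d) (hx : xx b ε y ≠ 0) :
    ∑ m ∈ Icc 1 d, covExt b d ε j m y = dlr b d ε j y := by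
  have hd : 1 ≤ d := by lia
  have hj' : j ∈ Icc 1 d := by simp; lia
  have h1 : 1 ∈ Icc 1 d := by simp [hd]
  have key : (slopeTerm d j (xx b ε y) - if j = 1 then (1 : ℝ) else 0) *
      (xx b ε y * (1 - xx b ε y)) = binomTerm d j (xx b ε y) * (d * xx b ε y - j) := by
    rw [slopeTerm, mul_binomTerm_succ_sub hj hjd, binomTerm]
    obtain ⟨m, rfl⟩ := Nat.exists_eq_add_of_lt hjd
    rw [show j + m + 1 - j = m + 1 by lia, Nat.add_sub_cancel m 1]
    field_simp
    ring
  have hand : ∀ m, (if j = 1 ∧ m = 1 then (1 : ℝ) else 0) =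
      (if j = 1 then (1 : ℝ) else 0) * (if m = 1 then (1 : ℝ) else 0) := by
    intro m; split_ifs <;> simp_all
  simp only [covExt, hand, dlr, G_eq_slopeTerm hj hjd hx]
  simp only [sum_sub_distrib, sum_add_distrib, ← sum_mul, ← mul_sum, sum_slopeTerm hd hx,
    sum_binomTerm hd, sum_ite_eq, sum_ite_eq', if_pos hj', if_pos h1]
  linear_combination key

lemma covExt_comm (b d : ℕ) (ε : ℝ) (k j : ℕ) (y : ℝ) :
    covExt b d ε k j y = covExt b d ε j k y := by
  rcases eq_or_ne k j with rfl | h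
  · rfl
  · simp only [covExt, if_neg h, if_neg h.symm, and_comm]
    ring

lemma Hfun_eq {b d k j : ℕ} {ε y : ℝ} (hk : 1 ≤ k) (hkd : k < d) (hj : 1 ≤ j) (hjd : j < d)
    (hx : xx b ε y ≠ 0) (hy : y ≠ 0) :
    Hfun b d ε k j y = (slopeTerm d k (xx b ε y) / y - (if k = 1 then (1 : ℝ) else 0)) * dlr b d ε j y
      - k * covExt b d ε (k + 1) j y := by
  have hne : k + 1 ≠ 1 := by lia
  have h1 : (k : ℝ) * (if k = 1 then (1 : ℝ) else 0) = if k = 1 then (1 : ℝ) else 0 := by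
    split_ifs with h <;> simp [h]
  have hE : (k : ℝ) * ((er b d ε (k + 1) y - er b d ε k y) / el b ε y) =
      slopeTerm d k (xx b ε y) / y - (if k = 1 then (1 : ℝ) else 0) := by
    simp only [er_eq, el, slopeTerm, if_neg hne]
    field_simp
    linear_combination (-xx b ε y * (y - 1)) * h1
  rw [Hfun, hE]
  by_cases hkd' : k = d - 1
  · have hkc : (k : ℝ) = d - 1 := by rw [hkd', Nat.cast_sub (by lia), Nat.cast_one]
    have hs := sum_covExt (b := b) (ε := ε) (y := y) hj hjd hx
    have hs' : ∑ m ∈ Icc 1 (d - 1), drr b d ε j m y = ∑ m ∈ Icc 1 (d - 1), covExt b d ε j m y := by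
      refine sum_congr rfl fun m hm => ?_
      rw [mem_Icc] at hm
      exact drr_eq_covExt hj hjd hm.1 (by lia) hx
    have hsplit : ∑ m ∈ Icc 1 d, covExt b d ε j m y =
        ∑ m ∈ Icc 1 (d - 1), covExt b d ε j m y + covExt b d ε j d y := by
      obtain ⟨n, rfl⟩ := Nat.exists_eq_add_of_le' (show 1 ≤ d by lia)
      exact sum_Icc_succ_top (by lia) _
    rw [if_neg (not_not.mpr hkd'), if_pos hkd', hs', covExt_comm b d ε (k + 1),
      show k + 1 = d by lia, hkc]
    linear_combination ((d : ℝ) - 1) * (hs - hsplit)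
  · rw [if_pos hkd', if_neg hkd', drr_eq_covExt (by lia) (by lia) hj hjd hx]
    ring

lemma el_mul_fhat {b d k j : ℕ} {ε y : ℝ} (hb : 2 ≤ b) (hk : 1 ≤ k) (hj : 1 ≤ j)
    (hx : xx b ε y ≠ 0) (hy : y ≠ 0) :
    el b ε y / ((b : ℝ) - 1) * fhat b d ε k j y =
      -(xx b ε y / y) * (slopeTerm d k (xx b ε y) - (if k = 1 then (1 : ℝ) else 0) * y) *
          (slopeTerm d j (xx b ε y) - (if j = 1 then (1 : ℝ) else 0) * y) +
        (k : ℝ) * j * ((if k = j then (1 : ℝ) else 0) *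
            (binomTerm d (j + 1) (xx b ε y) + binomTerm d j (xx b ε y)) -
          (if k = j + 1 then (1 : ℝ) else 0) * binomTerm d k (xx b ε y) -
          (if j = k + 1 then (1 : ℝ) else 0) * binomTerm d j (xx b ε y)) +
        (if k = 1 ∧ j = 1 then (1 : ℝ) else 0) * (xx b ε y * (y - 1)) := by
  have hb' : (b : ℝ) - 1 ≠ 0 := by
    have : (2 : ℝ) ≤ b := by exact_mod_cast hb
    linarith
  have hE : ∀ i : ℕ, 1 ≤ i → (i : ℝ) * (er b d ε (i + 1) y - er b d ε i y) =
      xx b ε y * (slopeTerm d i (xx b ε y) - (if i = 1 then (1 : ℝ) else 0) * y) := by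
    intro i hi
    have h1 : (i : ℝ) * (if i = 1 then (1 : ℝ) else 0) = if i = 1 then (1 : ℝ) else 0 := by
      split_ifs with h <;> simp [h]
    simp only [er_eq, slopeTerm, if_neg (show i + 1 ≠ 1 by lia)]
    field_simp
    linear_combination (-xx b ε y * (y - 1)) * h1
  have hprod : el b ε y / ((b : ℝ) - 1) * fhat b d ε k j y =
      -((k * (er b d ε (k + 1) y - er b d ε k y)) * (j * (er b d ε (j + 1) y - er b d ε j y))) /
          el b ε y +
        (k : ℝ) * j * ((if k = j then (1 : ℝ) else 0) * (er b d ε (j + 1) y + er b d ε j y) -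
          (if k = j + 1 then (1 : ℝ) else 0) * er b d ε k y -
          (if j = k + 1 then (1 : ℝ) else 0) * er b d ε j y) := by
    have : el b ε y ≠ 0 := mul_ne_zero hx hy
    rw [fhat]
    field_simp
    ring
  rw [hprod, hE k hk, hE j hj, el]
  have hdiag : (k : ℝ) * j * ((if k = j then (1 : ℝ) else 0) * (er b d ε (j + 1) y + er b d ε j y) -
          (if k = j + 1 then (1 : ℝ) else 0) * er b d ε k y -
          (if j = k + 1 then (1 : ℝ) else 0) * er b d ε j y) =
      (k : ℝ) * j * ((if k = j then (1 : ℝ) else 0) *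
            (binomTerm d (j + 1) (xx b ε y) + binomTerm d j (xx b ε y)) -
          (if k = j + 1 then (1 : ℝ) else 0) * binomTerm d k (xx b ε y) -
          (if j = k + 1 then (1 : ℝ) else 0) * binomTerm d j (xx b ε y)) +
        (if k = 1 ∧ j = 1 then (1 : ℝ) else 0) * (xx b ε y * (y - 1)) := by
    simp only [er_eq, if_neg (show j + 1 ≠ 1 by lia)]
    rcases eq_or_ne k j with rfl | hkj
    · rcases eq_or_ne k 1 with rfl | hk1
      · simp
        ring
      · simp [hk1]
    · rw [if_neg (show ¬(k = 1 ∧ j = 1) by lia)]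
      rcases eq_or_ne k (j + 1) with rfl | hkj'
      · simp [show j ≠ 0 by lia, show j ≠ j + 1 + 1 by lia]
      · rcases eq_or_ne j (k + 1) with rfl | hjk'
        · simp [show k ≠ 0 by lia, show k ≠ k + 1 + 1 by lia]
        · simp [hkj, hkj', hjk']
  rw [hdiag]
  field_simp
  ring

lemma hasDerivAt_covExt {b d k j : ℕ} (hb : 2 ≤ b) {ε y : ℝ} (hk : 1 ≤ k) (hkd : k < d)
    (hj : 1 ≤ j) (hjd : j < d) (hx : xx b ε y ≠ 0) (hy : y ≠ 0) :
    HasDerivAt (covExt b d ε k j)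
      (((b : ℝ) - 1) / y * (((k : ℝ) + j) * covExt b d ε k j y + Hfun b d ε k j y +
        Hfun b d ε j k y - el b ε y / ((b : ℝ) - 1) * fhat b d ε k j y)) y := by
  have hb' : (b : ℝ) ≠ 0 := by positivity
  have dx := hasDerivAt_xx hb ε hy
  have dp : ∀ i : ℕ, 1 ≤ i → i < d → HasDerivAt (fun z => binomTerm d i (xx b ε z))
      (((b : ℝ) - 1) / y *
        (i * (binomTerm d i (xx b ε y) - binomTerm d (i + 1) (xx b ε y)))) y := by
    intro i hi hid
    refine ((hasDerivAt_binomTerm hi hid.le hx).comp y dx).congr_deriv ?_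
    field_simp
  have ds : ∀ i : ℕ, 1 ≤ i → i < d → HasDerivAt (fun z => slopeTerm d i (xx b ε z))
      (((b : ℝ) - 1) / y *
        (((i : ℝ) - 1) * slopeTerm d i (xx b ε y) - i * slopeTerm d (i + 1) (xx b ε y))) y := by
    intro i hi hid
    refine ((hasDerivAt_slopeTerm hi hid hx).comp y dx).congr_deriv ?_
    field_simp
  have dA : HasDerivAt (fun z => ε * (1 - ε) * ((b : ℝ) - 1) / z ^ 2 -
      (ε - (1 - ε)) * xx b ε z / z + xx b ε z ^ 2)
      (-2 * (ε * (1 - ε) * ((b : ℝ) - 1)) / y ^ 3 -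
        (ε - (1 - ε)) * ((b : ℝ) - 2) * xx b ε y / y ^ 2 +
        2 * ((b : ℝ) - 1) / y * xx b ε y ^ 2) y := by
    refine ((((hasDerivAt_const y (ε * (1 - ε) * ((b : ℝ) - 1))).div (hasDerivAt_pow 2 y)
      (pow_ne_zero 2 hy)).sub ((dx.const_mul (ε - (1 - ε))).div (hasDerivAt_id y) hy)).add
        (dx.pow 2)).congr_deriv ?_
    simp only [id]
    field_simp
    ring
  have dB : HasDerivAt (fun z => ε * (1 - ε) * ((b : ℝ) - 1) / z - ε * xx b ε z + xx b ε z ^ 2)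
      (-(ε * (1 - ε) * ((b : ℝ) - 1)) / y ^ 2 - ε * (((b : ℝ) - 1) / y * xx b ε y) +
        2 * ((b : ℝ) - 1) / y * xx b ε y ^ 2) y := by
    refine ((((hasDerivAt_const y (ε * (1 - ε) * ((b : ℝ) - 1))).div (hasDerivAt_id y) hy).sub
      (dx.const_mul ε)).add (dx.pow 2)).congr_deriv ?_
    simp only [id]
    field_simp
    ring
  have dC : HasDerivAt (fun z => (b : ℝ) * ε * (1 - ε) - xx b ε z * (1 - xx b ε z))
      (((b : ℝ) - 1) / y * (2 * xx b ε y ^ 2 - xx b ε y)) y := by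
    refine ((dx.mul (dx.const_sub 1)).const_sub ((b : ℝ) * ε * (1 - ε))).congr_deriv ?_
    ring
  have h := ((((((ds k hk hkd).const_mul (((b : ℝ) - 1) / (b : ℝ))).fun_mul (ds j hj hjd)).fun_mul dA).fun_sub
    (((dp k hk hkd).const_mul (d : ℝ)).fun_mul (dp j hj hjd))).fun_add
    ((dp k hk hkd).const_mul ((if k = j then (1 : ℝ) else 0) * (k : ℝ)))).fun_add
    (dC.const_mul (if k = 1 ∧ j = 1 then (1 : ℝ) else 0)) |>.fun_sub
    ((((ds j hj hjd).const_mul (if k = 1 then (1 : ℝ) else 0)).fun_add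
      ((ds k hk hkd).const_mul (if j = 1 then (1 : ℝ) else 0))).fun_mul dB)
  refine h.congr_deriv ?_
  rw [el_mul_fhat hb hk hj hx hy, Hfun_eq hk hkd hj hjd hx hy, Hfun_eq hj hjd hk hkd hx hy]
  have hk' : k + 1 ≠ 1 := by lia
  have hj' : j + 1 ≠ 1 := by lia
  simp only [covExt, dlr, G_eq_slopeTerm hk hkd hx, G_eq_slopeTerm hj hjd hx, false_and, if_false, hk',
    hj']
  rcases eq_or_ne k j with rfl | hkj
  · rcases eq_or_ne k 1 with rfl | hk1
    · simp
      field_simp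
      ring
    · simp [hk1]
      field_simp
      ring
  · have hand : ¬(k = 1 ∧ j = 1) := by lia
    rcases eq_or_ne k (j + 1) with rfl | hkj'
    · simp only [hkj, hj', if_true, if_false, false_and,
        show j ≠ j + 1 + 1 by lia, show j + 1 + 1 ≠ j by lia]
      by_cases hj1 : j = 1
      · have hjc : (j : ℝ) = 1 := by rw [hj1, Nat.cast_one]
        simp only [if_pos hj1]
        push_cast
        simp only [hjc]
        field_simp
        ring
      · simp only [hj1, if_false]
        push_cast
        field_simp
        ring
    · rcases eq_or_ne j (k + 1) with rfl | hjk'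
      · simp only [hkj, hk', if_true, if_false, and_false,
          show k ≠ k + 1 + 1 by lia, show k + 1 + 1 ≠ k by lia]
        by_cases hk1 : k = 1
        · have hkc : (k : ℝ) = 1 := by rw [hk1, Nat.cast_one]
          simp only [if_pos hk1]
          push_cast
          simp only [hkc]
          field_simp
          ring
        · simp only [hk1, if_false]
          push_cast
          field_simp
          ring
      · simp only [hkj, hkj', hkj'.symm, hjk', hjk'.symm, hand, if_false]
        rcases eq_or_ne k 1 with rfl | hk1
        · simp only [if_true, if_neg hkj.symm, Nat.cast_one]
          field_simp
          ring
        · simp only [hk1, if_false]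
          rcases eq_or_ne j 1 with rfl | hj1
          · simp only [if_true, Nat.cast_one]
            field_simp
            ring
          · simp only [hj1, if_false]
            field_simp
            ring

/-- Verification of Theorem 1, check–check part: for `k, j ∈ {1,…,d−1}` the function
`δ_{r_k,r_j}` is differentiable on `(0,∞)` with
`d/dy δ_{r_k,r_j}(y) = ((b−1)/y)·((k+j)·δ_{r_k,r_j}(y) + H_{k,j}(y) + H_{j,k}(y)
  − (ē_l(y)/(b−1))·f̂_{k,j}(y))`. -/
theorem drr_hasDerivAt (b d : ℕ) (hb : 2 ≤ b) (hd : 2 ≤ d) (ε : ℝ)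
    (hε0 : 0 < ε) (hε1 : ε < 1) (k j : ℕ) (hk1 : 1 ≤ k) (hk2 : k ≤ d - 1)
    (hj1 : 1 ≤ j) (hj2 : j ≤ d - 1) (y : ℝ) (hy : 0 < y) :
    HasDerivAt (drr b d ε k j)
      ((((b : ℝ) - 1) / y) *
        (((k : ℝ) + (j : ℝ)) * drr b d ε k j y + Hfun b d ε k j y + Hfun b d ε j k y -
          (el b ε y / ((b : ℝ) - 1)) * fhat b d ε k j y)) y := by
  have hk : k < d := by lia
  have hj : j < d := by lia
  have hx : xx b ε y ≠ 0 := (xx_pos hε0 hy).ne'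
  rw [drr_eq_covExt hk1 hk hj1 hj hx]
  refine (hasDerivAt_covExt hb hk1 hk hj1 hj hx hy.ne').congr_of_eventuallyEq ?_
  filter_upwards [lt_mem_nhds hy] with z hz
  exact drr_eq_covExt hk1 hk hj1 hj (xx_pos hε0 hz).ne'
end

section
/- For every j ∈ {2,…,d−1} and all y > 0, the sum Σ_{k=1}^{d−1} δ_{r_j,r_k}(y) equals −((b−1)/b)·G_d(y)·G_j(y)·( (b−1)·ε·ε̃/y² − (ε−ε̃)·x/y + x² ) − G_j(y)·( (b−1)·ε·ε̃/y + ε̃·x ) + d·C(d−1,j−1)·x^(d+j)·x̃^(d−j). -/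
open Finset Filter

/-- The binomial expansion of `1 = (x + (1 - x)) ^ n` without its top term. -/
theorem sum_range_choose_mul_pow_mul_one_sub_pow (n : ℕ) (x : ℝ) :
    ∑ i ∈ Finset.range n, (n.choose i : ℝ) * x ^ i * (1 - x) ^ (n - i) = 1 - x ^ n := by
  have h := add_pow x (1 - x) n
  rw [Finset.sum_range_succ] at h
  simp only [add_sub_cancel, one_pow, Nat.sub_self, Nat.choose_self, pow_zero, Nat.cast_one,
    mul_one] at h
  refine eq_sub_of_add_eq (Eq.trans ?_ h.symm)
  congr 1
  exact Finset.sum_congr rfl fun i _ => by ring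

/-- The derivative of `x * (1 - x ^ n)`, expanded in the Bernstein basis. -/
theorem sum_range_choose_mul_pow_mul_one_sub_pow_mul (n : ℕ) (x : ℝ) :
    ∑ i ∈ Finset.range n, (n.choose i : ℝ) * x ^ i * (1 - x) ^ (n - i - 1) *
      ((n + 1) * x - (i + 1)) = (n + 1) * x ^ n - 1 := by
  have h₁ : HasDerivAt (fun t : ℝ => ∑ i ∈ Finset.range n,
      (n.choose i : ℝ) * (t ^ (i + 1) * (1 - t) ^ (n - i)))
      (∑ i ∈ Finset.range n, (n.choose i : ℝ) * x ^ i * (1 - x) ^ (n - i - 1) *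
        ((i + 1) - (n + 1) * x)) x := by
    refine HasDerivAt.fun_sum fun i hi => ?_
    obtain ⟨m, rfl⟩ := Nat.exists_eq_add_of_lt (Finset.mem_range.mp hi)
    rw [show i + m + 1 - i = m + 1 by omega]
    have h := ((hasDerivAt_pow (i + 1) x).fun_mul
      (((hasDerivAt_id x).const_sub 1).fun_pow (m + 1))).const_mul ((i + m + 1).choose i : ℝ)
    refine h.congr_deriv ?_
    simp only [id, Nat.add_sub_cancel]
    push_cast
    ring
  have h₂ : HasDerivAt (fun t : ℝ => t - t ^ (n + 1)) (1 - (n + 1) * x ^ n) x := by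
    have h := (hasDerivAt_id x).fun_sub (hasDerivAt_pow (n + 1) x)
    simpa using h
  have hfun : (fun t : ℝ => ∑ i ∈ Finset.range n,
      (n.choose i : ℝ) * (t ^ (i + 1) * (1 - t) ^ (n - i))) = fun t => t - t ^ (n + 1) := by
    funext t
    rw [show t - t ^ (n + 1) = t * (1 - t ^ n) by ring,
      ← sum_range_choose_mul_pow_mul_one_sub_pow, Finset.mul_sum]
    exact Finset.sum_congr rfl fun i _ => by ring
  rw [hfun] at h₁
  have h := h₁.unique h₂
  rw [← neg_inj, ← Finset.sum_neg_distrib, neg_sub, ← h]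
  exact Finset.sum_congr rfl fun i _ => by ring

theorem sum_Icc_one_eq_sum_range {M : Type*} [AddCommMonoid M] (f : ℕ → M) (n : ℕ) :
    ∑ k ∈ Finset.Icc 1 n, f k = ∑ i ∈ Finset.range n, f (i + 1) := by
  rw [Finset.range_eq_Ico, Finset.sum_Ico_add' f 0 n 1]
  rfl

/-- The functions `G_1, …, G_d` sum to zero. -/
theorem sum_G (b d : ℕ) (hd : 2 ≤ d) (ε y : ℝ) :
    ∑ k ∈ Finset.Icc 1 (d - 1), G b d ε k y = -Gd b d ε y := by
  obtain ⟨n, rfl⟩ : ∃ n, d = n + 1 := ⟨d - 1, by omega⟩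
  have h1 : 1 ∈ Finset.Icc 1 n := Finset.mem_Icc.mpr ⟨le_rfl, by omega⟩
  simp only [G, Gd, Nat.add_sub_cancel, Finset.sum_add_distrib, Finset.sum_ite_eq', h1, if_true]
  rw [sum_Icc_one_eq_sum_range]
  have h := sum_range_choose_mul_pow_mul_one_sub_pow_mul n (xx b ε y)
  simp only [Nat.add_sub_cancel, Nat.add_sub_add_right, Nat.cast_add, Nat.cast_one]
  linear_combination h

/-- For `j ∈ {2,…,d−1}` and `y > 0`, `Σ_{k=1}^{d−1} δ_{r_j,r_k}(y)
  = −((b−1)/b)·G_d(y)·G_j(y)·((b−1)·ε·ε̃/y² − (ε−ε̃)·x/y + x²)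
    − G_j(y)·((b−1)·ε·ε̃/y + ε̃·x) + d·C(d−1,j−1)·x^(d+j)·x̃^(d−j)`. -/
theorem sum_drr_row (b d : ℕ) (hb : 2 ≤ b) (hd : 2 ≤ d) (ε : ℝ)
    (hε0 : 0 < ε) (hε1 : ε < 1) (j : ℕ) (hj1 : 2 ≤ j) (hj2 : j ≤ d - 1)
    (y : ℝ) (hy : 0 < y) :
    ∑ k ∈ Finset.Icc 1 (d - 1), drr b d ε j k y =
      -((((b : ℝ) - 1) / (b : ℝ)) * Gd b d ε y * G b d ε j y *
          (((b : ℝ) - 1) * ε * (1 - ε) / y ^ 2 - (ε - (1 - ε)) * xx b ε y / y +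
            xx b ε y ^ 2)) -
        G b d ε j y * (((b : ℝ) - 1) * ε * (1 - ε) / y + (1 - ε) * xx b ε y) +
        (d : ℝ) * (Nat.choose (d - 1) (j - 1) : ℝ) * xx b ε y ^ (d + j) *
          (1 - xx b ε y) ^ (d - j) := by
  have hj : j ≠ 1 := by omega
  have hmem : j ∈ Finset.Icc 1 (d - 1) := Finset.mem_Icc.mpr ⟨by omega, hj2⟩
  have h1 : 1 ∈ Finset.Icc 1 (d - 1) := Finset.mem_Icc.mpr ⟨le_rfl, by omega⟩
  have hG := sum_G b d hd ε y
  have hGj : G b d ε j y * (1 - xx b ε y) * xx b ε y =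
      ((d - 1).choose (j - 1) : ℝ) * xx b ε y ^ j * (1 - xx b ε y) ^ (d - j) *
        ((d : ℝ) * xx b ε y - j) := by
    rw [G, if_neg hj, ← pow_sub_one_mul (show j ≠ 0 by omega) (xx b ε y),
      ← pow_sub_one_mul (show d - j ≠ 0 by omega) (1 - xx b ε y)]
    ring
  have hB : ∑ k ∈ Finset.Icc 1 (d - 1), ((d - 1).choose (k - 1) : ℝ) * xx b ε y ^ (j + k) *
      (1 - xx b ε y) ^ (2 * d - j - k) =
      xx b ε y ^ (j + 1) * (1 - xx b ε y) ^ (d - j) * (1 - xx b ε y ^ (d - 1)) := by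
    rw [sum_Icc_one_eq_sum_range, ← sum_range_choose_mul_pow_mul_one_sub_pow, Finset.mul_sum]
    refine Finset.sum_congr rfl fun i hi => ?_
    have hi' := Finset.mem_range.mp hi
    rw [show 2 * d - j - (i + 1) = (d - j) + (d - 1 - i) by omega, Nat.add_sub_cancel]
    ring
  have hrow : ∀ k ∈ Finset.Icc 1 (d - 1), drr b d ε j k y =
      (((b : ℝ) - 1) / b * G b d ε j y * (ε * (1 - ε) * ((b : ℝ) - 1) / y ^ 2 -
        (ε - (1 - ε)) * xx b ε y / y + xx b ε y ^ 2)) * G b d ε k y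
      - ((d : ℝ) * (d - 1).choose (j - 1)) * (((d - 1).choose (k - 1) : ℝ) * xx b ε y ^ (j + k) *
        (1 - xx b ε y) ^ (2 * d - j - k))
      + (if j = k then (j : ℝ) * (d - 1).choose (j - 1) * xx b ε y ^ j *
        (1 - xx b ε y) ^ (d - j) else 0)
      - (if 1 = k then G b d ε j y * (ε * (1 - ε) * ((b : ℝ) - 1) / y - ε * xx b ε y +
        xx b ε y ^ 2) else 0) := by
    intro k _
    simp only [drr, hj, false_and, if_false, eq_comm (a := k) (b := 1)]
    split_ifs <;> ring
  have hp : xx b ε y ^ (d + j) = xx b ε y ^ (j + 1) * xx b ε y ^ (d - 1) := by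
    rw [← pow_add]
    congr 1
    omega
  rw [Finset.sum_congr rfl hrow, Finset.sum_sub_distrib, Finset.sum_add_distrib,
    Finset.sum_sub_distrib, ← Finset.mul_sum, ← Finset.mul_sum, hG, hB,
    Finset.sum_ite_eq, Finset.sum_ite_eq, if_pos hmem, if_pos h1, hp]
  linear_combination hGj
end
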